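/- Let $a\in(-1,1)$ and let $\widetilde u$ be the degenerate heat kernel. There exist constants $0<c\le C$ depending only on $a$ such that for all $x,y\in\mathbb{R}$ and $t>0$: $c\, t^{-(1+a)/2} e^{-|x-y|^2/(4t)}\big(1+|xy/t|\big)^{-a/2} \le \widetilde u(x,y,t) \le C\, t^{-(1+a)/2} e^{-|x-y|^2/(4t)}\big(1+|xy/t|\big)^{-a/2}$. -/

import Mathlib

noncomputable section
open Real

/-- The Bessel-type profile `F(z)` with `ν = (a-1)/2`:
`F(z) = e^{-z/2} ( ∑_k (z/4)^{2k}/(k! Γ(k+ν+1)) + (z/4)|z/4|^{-a} ∑_k (z/4)^{2k}/(k! Γ(k-ν+1)) )`. -/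
def Fker (a z : ℝ) : ℝ :=
  Real.exp (-z / 2) *
    ((∑' k : ℕ, (z / 4) ^ (2 * k) / ((Nat.factorial k : ℝ) * Real.Gamma ((k : ℝ) + (a - 1) / 2 + 1))) +
      z / 4 * |z / 4| ^ (-a) *
        ∑' k : ℕ, (z / 4) ^ (2 * k) / ((Nat.factorial k : ℝ) * Real.Gamma ((k : ℝ) - (a - 1) / 2 + 1)))

/-- The one-dimensional degenerate heat kernel
`ũ(x,y,t) = (4t)^{-(a+1)/2} e^{-(x-y)²/(4t)} F(xy/t)`. -/
def utilde (a x y t : ℝ) : ℝ :=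
  (4 * t) ^ (-(a + 1) / 2) * Real.exp (-(x - y) ^ 2 / (4 * t)) * Fker a (x * y / t)

open Filter Topology MeasureTheory Set

def SB (b q : ℝ) : ℝ := ∑' k : ℕ, q ^ k / ((Nat.factorial k : ℝ) * Real.Gamma ((k : ℝ) + b))

lemma Gamma_lb {b : ℝ} (hb : 0 < b) : ∃ m > 0, ∀ k : ℕ, m ≤ Real.Gamma ((k : ℝ) + b) := by
  refine ⟨min (Real.Gamma b) (Real.Gamma (b + 1)), lt_min (Real.Gamma_pos_of_pos hb)
    (Real.Gamma_pos_of_pos (by linarith)), ?_⟩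
  intro k
  rcases k with _ | k
  · simp
  · refine (min_le_right _ _).trans ?_
    induction k with
    | zero => simp [add_comm]
    | succ k ih =>
      refine ih.trans ?_
      have h0 : 0 < (((k + 1 : ℕ) : ℝ) + b) := by positivity
      have : (((k + 1 + 1 : ℕ) : ℝ) + b) = (((k + 1 : ℕ) : ℝ) + b) + 1 := by push_cast; ring
      rw [this, Real.Gamma_add_one h0.ne']
      have h1 : 1 ≤ (((k + 1 : ℕ) : ℝ) + b) := by
        push_cast; have : (0:ℝ) ≤ k := by positivity
        linarith
      exact le_mul_of_one_le_left (Real.Gamma_pos_of_pos h0).le h1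

lemma GkP {b : ℝ} (hb : 0 < b) (k : ℕ) : 0 < Real.Gamma ((k : ℝ) + b) :=
  Real.Gamma_pos_of_pos (by positivity)

lemma SB_summable {b : ℝ} (hb : 0 < b) (q : ℝ) :
    Summable fun k : ℕ => q ^ k / ((Nat.factorial k : ℝ) * Real.Gamma ((k : ℝ) + b)) := by
  obtain ⟨m, hm, h⟩ := Gamma_lb hb
  refine Summable.of_norm_bounded (g := fun k : ℕ => m⁻¹ * (|q| ^ k / (Nat.factorial k : ℝ)))
    ((Real.summable_pow_div_factorial |q|).mul_left _) ?_
  intro k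
  have := GkP hb k
  rw [Real.norm_eq_abs, abs_div, abs_pow, abs_of_pos (a := _ * _) (by positivity), ← div_div, inv_mul_eq_div]
  gcongr
  exact h k

lemma SB_zero (b : ℝ) : SB b 0 = 1 / Real.Gamma b := by
  rw [SB, tsum_eq_single 0]
  · simp
  · intro k hk; simp [hk]

lemma SB_pos {b : ℝ} (hb : 0 < b) {q : ℝ} (hq : 0 ≤ q) : 0 < SB b q := by
  refine (SB_summable hb q).tsum_pos (fun k => ?_) 0 ?_
  · have := GkP hb k
    positivity
  · have := GkP hb 0
    simp at this ⊢
    positivity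

/-- shifted series -/
lemma SB_shift {b : ℝ} (hb : 0 < b) (q : ℝ) :
    HasSum (fun k : ℕ => (k : ℝ) * q ^ (k - 1) / ((Nat.factorial k : ℝ) * Real.Gamma ((k : ℝ) + b)))
      (SB (b + 1) q) := by
  rw [← hasSum_nat_add_iff' 1]
  simp only [Finset.range_one, Finset.sum_singleton, Nat.cast_zero, zero_mul, zero_div, sub_zero]
  convert! (SB_summable (b := b + 1) (by linarith) q).hasSum using 2 with k
  rw [Nat.factorial_succ]
  have : (((k + 1 : ℕ) : ℝ) + b) = (k : ℝ) + (b + 1) := by push_cast; ring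
  rw [this]
  have := GkP (b := b + 1) (by linarith) k
  push_cast
  field_simp

lemma SB_rec {b : ℝ} (hb : 0 < b) (q : ℝ) : SB b q = b * SB (b + 1) q + q * SB (b + 2) q := by
  have h1 : HasSum _ (b * SB (b + 1) q) := ((SB_summable (b := b + 1) (by linarith) q).hasSum).mul_left b
  have h2 := (SB_shift (b := b + 1) (by linarith) q).mul_left q
  have h3 := h1.add h2
  have e : b + 1 + 1 = b + 2 := by ring
  rw [e] at h3
  rw [← HasSum.tsum_eq h3, SB]
  congr 1
  ext k
  have h0 : 0 < (k : ℝ) + b := by positivity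
  have : (k : ℝ) + (b + 1) = (k + b) + 1 := by ring
  rw [this, Real.Gamma_add_one h0.ne']
  have := GkP hb k
  rcases k with _ | k
  · simp at this h0 ⊢; field_simp
  · simp only [Nat.add_sub_cancel]
    field_simp
    ring

lemma SB_deriv {b : ℝ} (hb : 0 < b) (q : ℝ) : HasDerivAt (SB b) (SB (b + 1) q) q := by
  obtain ⟨m, hm, h⟩ := Gamma_lb hb
  have hs : Summable (fun k : ℕ => m⁻¹ * ((k : ℝ) * (|q| + 1) ^ (k - 1) / (Nat.factorial k : ℝ))) := by
    apply Summable.mul_left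
    rw [← summable_nat_add_iff 1]
    convert! (Real.summable_pow_div_factorial (|q| + 1)) using 2 with k
    rw [Nat.factorial_succ]
    push_cast
    field_simp
  rw [← (SB_shift hb q).tsum_eq]
  refine hasDerivAt_tsum_of_isPreconnected (t := Metric.ball 0 (|q| + 1)) (y₀ := 0) hs
    Metric.isOpen_ball (convex_ball _ _).isPreconnected
    (g := fun (k : ℕ) (q : ℝ) => q ^ k / ((Nat.factorial k : ℝ) * Real.Gamma ((k : ℝ) + b)))
    (g' := fun (k : ℕ) (q : ℝ) => (k : ℝ) * q ^ (k - 1) / ((Nat.factorial k : ℝ) * Real.Gamma ((k : ℝ) + b)))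
    ?_ ?_ ?_ (SB_summable hb 0) ?_
  · intro k y _
    exact (hasDerivAt_pow k y).div_const _
  · intro k y hy
    have := GkP hb k
    have hy' : |y| ≤ |q| + 1 := by
      have := (mem_ball_zero_iff.1 hy).le
      simpa using this
    rw [Real.norm_eq_abs, abs_div, abs_mul, abs_pow, abs_of_pos (a := _ * _) (by positivity), ← div_div,
      inv_mul_eq_div, Nat.abs_cast]
    gcongr
    exact h k
  · simp; positivity
  · simp

lemma SB_cont {b : ℝ} (hb : 0 < b) : Continuous (SB b) :=
  continuous_iff_continuousAt.2 fun q => (SB_deriv hb q).continuousAt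

lemma SB_wronsk {b : ℝ} (hb : 0 < b) (hb1 : b < 1) (q : ℝ) :
    SB b q * SB (1 - b) q - q * (SB (b + 1) q * SB (2 - b) q) =
      1 / (Real.Gamma b * Real.Gamma (1 - b)) := by
  have hd : ∀ q, HasDerivAt (fun q => SB b q * SB (1 - b) q - q * (SB (b + 1) q * SB (2 - b) q)) 0 q := by
    intro q
    have h1 := SB_deriv hb q
    have h2 := SB_deriv (b := 1 - b) (by linarith) q
    have h3 := SB_deriv (b := b + 1) (by linarith) q
    have h4 := SB_deriv (b := 2 - b) (by linarith) q
    have r1 := SB_rec hb q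
    have r2 := SB_rec (b := 1 - b) (by linarith) q
    have e1 : 1 - b + 1 = 2 - b := by ring
    have e2 : 1 - b + 2 = 3 - b := by ring
    have e3 : b + 1 + 1 = b + 2 := by ring
    have e4 : 2 - b + 1 = 3 - b := by ring
    rw [e1] at h2 r2
    rw [e2] at r2
    rw [e3] at h3
    rw [e4] at h4
    refine ((h1.mul h2).sub ((hasDerivAt_id q).mul (h3.mul h4))).congr_deriv ?_
    simp only [id, Pi.mul_apply]
    rw [r1, r2]
    ring
  have := is_const_of_deriv_eq_zero (fun q => (hd q).differentiableAt) (fun q => (hd q).deriv) q 0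
  rw [this, SB_zero, SB_zero]
  have := Real.Gamma_pos_of_pos hb
  have := Real.Gamma_pos_of_pos (s := 1 - b) (by linarith)
  rw [zero_mul, sub_zero]
  field_simp

lemma beta_real {b c : ℝ} (hb : 0 < b) (hc : 0 < c) :
    IntegrableOn (fun u : ℝ => u ^ (b - 1) * (1 - u) ^ (c - 1)) (Ioc 0 1) ∧
    ∫ u in Ioc (0 : ℝ) 1, u ^ (b - 1) * (1 - u) ^ (c - 1) =
      Real.Gamma b * Real.Gamma c / Real.Gamma (b + c) := by
  have hconv := Complex.betaIntegral_convergent (u := b) (v := c) (by simpa) (by simpa)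
  rw [intervalIntegrable_iff_integrableOn_Ioc_of_le (by simp)] at hconv
  have hcongr : ∀ x ∈ Ioc (0 : ℝ) 1,
      RCLike.re ((x : ℂ) ^ ((b : ℂ) - 1) * (1 - (x : ℂ)) ^ ((c : ℂ) - 1)) =
      x ^ (b - 1) * (1 - x) ^ (c - 1) := by
    rintro x ⟨hx1, hx2⟩
    norm_cast
    rw [← Complex.ofReal_cpow, ← Complex.ofReal_cpow, RCLike.re_to_complex,
        Complex.re_mul_ofReal, Complex.ofReal_re]
    all_goals linarith
  constructor
  · refine IntegrableOn.congr_fun ?_ hcongr measurableSet_Ioc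
    exact hconv.re
  · have h := ProbabilityTheory.beta_eq_betaIntegralReal b c hb hc
    rw [ProbabilityTheory.beta] at h
    rw [h, Complex.betaIntegral, intervalIntegral.integral_of_le (by norm_num),
      ← RCLike.re_to_complex, ← integral_re hconv]
    exact (setIntegral_congr_fun measurableSet_Ioc hcongr).symm

lemma dup (k : ℕ) : 2 * 4 ^ k * ((Nat.factorial k : ℝ) * Real.Gamma (k + 3 / 2)) =
    √π * ((2 * k + 1).factorial : ℝ) := by
  have h := Real.Gamma_mul_Gamma_add_half ((k : ℝ) + 1)
  rw [Real.Gamma_nat_eq_factorial] at h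
  have e1 : (k : ℝ) + 1 + 1 / 2 = k + 3 / 2 := by ring
  have e2 : 2 * ((k : ℝ) + 1) = ((2 * k + 1 : ℕ) : ℝ) + 1 := by push_cast; ring
  have e3 : (1 : ℝ) - (((2 * k + 1 : ℕ) : ℝ) + 1) = - ((2 * k + 1 : ℕ) : ℝ) := by ring
  rw [e1, e2, Real.Gamma_nat_eq_factorial, e3, Real.rpow_neg (by norm_num), Real.rpow_natCast] at h
  rw [h, pow_succ, pow_mul]
  norm_num
  field_simp

lemma SB_integral {b : ℝ} (hb : 0 < b) {r : ℝ} (hr : 0 < r) :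
    ∫ u in Ioc (0 : ℝ) 1, u ^ (b - 1) * (Real.sinh (2 * r * √(1 - u)) / r) =
      √π * Real.Gamma b * SB (b + 3 / 2) (r ^ 2) := by
  set F : ℕ → ℝ → ℝ := fun k u => (2 * (2 * r) ^ (2 * k) / ((2 * k + 1).factorial : ℝ)) *
    (u ^ (b - 1) * (1 - u) ^ (((k : ℝ) + 3 / 2) - 1)) with hF
  have hint : ∀ k, Integrable (F k) (volume.restrict (Ioc (0 : ℝ) 1)) := fun k =>
    (beta_real hb (c := (k : ℝ) + 3 / 2) (by positivity)).1.const_mul _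
  have hval : ∀ k, ∫ u in Ioc (0 : ℝ) 1, F k u =
      √π * Real.Gamma b * ((r ^ 2) ^ k / ((Nat.factorial k : ℝ) * Real.Gamma ((k : ℝ) + (b + 3 / 2)))) := by
    intro k
    rw [hF]
    simp only
    rw [integral_const_mul, (beta_real hb (c := (k : ℝ) + 3 / 2) (by positivity)).2]
    have e : b + ((k : ℝ) + 3 / 2) = k + (b + 3 / 2) := by ring
    rw [e]
    have hd := dup k
    have := GkP (b := b + 3 / 2) (by linarith) k
    rw [mul_pow, pow_mul, pow_mul]
    norm_num
    generalize Real.Gamma ((k : ℝ) + 3 / 2) = g at hd ⊢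
    field_simp
    linear_combination hd
  have hnn : ∀ k, ∀ u ∈ Ioc (0 : ℝ) 1, ‖F k u‖ = F k u := by
    rintro k u ⟨h1, h2⟩
    rw [Real.norm_of_nonneg]
    have : 0 ≤ 1 - u := by linarith
    simp only [hF]
    positivity
  have hsum := hasSum_integral_of_summable_integral_norm hint (by
    have : (fun k => ∫ u in Ioc (0 : ℝ) 1, ‖F k u‖) = fun k =>
      √π * Real.Gamma b * ((r ^ 2) ^ k / ((Nat.factorial k : ℝ) * Real.Gamma ((k : ℝ) + (b + 3 / 2)))) := by
      ext k
      rw [← hval k]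
      exact setIntegral_congr_fun measurableSet_Ioc (hnn k)
    rw [this]
    exact (SB_summable (by linarith) _).mul_left _)
  simp_rw [hval] at hsum
  have h2 := ((SB_summable (b := b + 3 / 2) (by linarith) (r ^ 2)).hasSum).mul_left (√π * Real.Gamma b)
  rw [SB, h2.unique hsum]
  refine setIntegral_congr_fun measurableSet_Ioc ?_
  rintro u ⟨hu1, hu2⟩
  have h0 : 0 ≤ 1 - u := by linarith
  have hs := ((Real.hasSum_sinh (2 * r * √(1 - u))).div_const r).mul_left (u ^ (b - 1))
  simp only
  rw [← hs.tsum_eq]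
  congr 1
  ext k
  simp only [hF]
  have : (1 - u) ^ (((k : ℝ) + 3 / 2) - 1) = √(1 - u) ^ (2 * k + 1) := by
    rw [Real.sqrt_eq_rpow, ← Real.rpow_mul_natCast h0]
    congr 1
    push_cast
    ring
  rw [this]
  field_simp
  rw [mul_pow (2 * r), pow_succ (2 * r)]
  ring

lemma sqrt_bd {r v : ℝ} (hr : 0 < r) (hv : v ≤ r) : 2 * r * √(1 - v / r) ≤ 2 * r - v := by
  have h : √(1 - v / r) ≤ 1 - (v / r) / 2 := by
    have : v / r ≤ 1 := (div_le_one hr).2 hv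
    rw [Real.sqrt_le_iff]
    constructor
    · linarith
    · nlinarith [sq_nonneg (v / r)]
  calc 2 * r * √(1 - v / r) ≤ 2 * r * (1 - (v / r) / 2) := by gcongr
    _ = 2 * r - v := by field_simp

lemma ptlim (v : ℝ) : Tendsto (fun r : ℝ => Real.exp (-2 * r) * Real.sinh (2 * r * √(1 - v / r)))
    atTop (𝓝 (Real.exp (-v) / 2)) := by
  have hs : Tendsto (fun r : ℝ => √(1 - v / r)) atTop (𝓝 1) := by
    have : Tendsto (fun r : ℝ => 1 - v / r) atTop (𝓝 (1 - 0)) :=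
      tendsto_const_nhds.sub (tendsto_const_nhds.div_atTop tendsto_id)
    simpa using this.sqrt
  have h1 : Tendsto (fun r : ℝ => Real.exp (-2 * v / (√(1 - v / r) + 1))) atTop (𝓝 (Real.exp (-v))) := by
    have : Tendsto (fun r : ℝ => -2 * v / (√(1 - v / r) + 1)) atTop (𝓝 (-2 * v / (1 + 1))) :=
      tendsto_const_nhds.div (hs.add_const 1) (by norm_num)
    have e : -2 * v / (1 + 1) = -v := by ring
    rw [e] at this
    exact (Real.continuous_exp.tendsto _).comp this
  have h2 : Tendsto (fun r : ℝ => Real.exp (-2 * r - 2 * r * √(1 - v / r))) atTop (𝓝 0) := by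
    refine squeeze_zero' (Eventually.of_forall fun r => (Real.exp_pos _).le) (g := fun r => Real.exp (-r)) ?_
      (Real.tendsto_exp_neg_atTop_nhds_zero)
    filter_upwards [eventually_gt_atTop 0] with r hr
    apply Real.exp_le_exp.2
    have : 0 ≤ 2 * r * √(1 - v / r) := by positivity
    linarith
  have h3 := (h1.sub h2).div_const 2
  rw [sub_zero] at h3
  refine h3.congr' ?_
  filter_upwards [eventually_gt_atTop 0, eventually_gt_atTop v] with r hr hrv
  rw [Real.sinh_eq, mul_div_assoc', mul_sub, ← Real.exp_add, ← Real.exp_add]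
  have h0 : 0 ≤ 1 - v / r := by
    rw [sub_nonneg, div_le_one hr]; exact hrv.le
  have hsq := Real.sq_sqrt h0
  have hnn := Real.sqrt_nonneg (1 - v / r)
  set w := √(1 - v / r)
  have hv : v = r * (1 - w ^ 2) := by rw [hsq]; field_simp; ring
  congr 4
  rw [hv]
  field_simp
  ring

lemma SB_scaled {b : ℝ} (hb : 0 < b) {r : ℝ} (hr : 0 < r) :
    √π * Real.Gamma b * (r ^ (b + 1) * Real.exp (-2 * r) * SB (b + 3 / 2) (r ^ 2)) =
    ∫ v in Ioi (0 : ℝ), (Ioc (0 : ℝ) r).indicator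
      (fun v => v ^ (b - 1) * (Real.exp (-2 * r) * Real.sinh (2 * r * √(1 - v / r)))) v := by
  rw [setIntegral_indicator measurableSet_Ioc, inter_eq_right.2 (fun x hx => hx.1),
    ← intervalIntegral.integral_of_le hr.le]
  have h := intervalIntegral.integral_comp_div (a := 0) (b := r) (c := r)
    (fun u => u ^ (b - 1) * (Real.sinh (2 * r * √(1 - u)) / r)) hr.ne'
  rw [zero_div, div_self hr.ne', intervalIntegral.integral_of_le zero_le_one, SB_integral hb hr,
    smul_eq_mul] at h
  have : √π * Real.Gamma b * (r ^ (b + 1) * Real.exp (-2 * r) * SB (b + 3 / 2) (r ^ 2)) =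
    (r ^ b * Real.exp (-2 * r)) * (r * (√π * Real.Gamma b * SB (b + 3 / 2) (r ^ 2))) := by
    rw [Real.rpow_add_one hr.ne']; ring
  rw [this, ← h, ← intervalIntegral.integral_const_mul]
  rw [intervalIntegral.integral_of_le hr.le, intervalIntegral.integral_of_le hr.le]
  refine setIntegral_congr_fun measurableSet_Ioc ?_
  rintro v ⟨hv1, hv2⟩
  simp only
  rw [Real.div_rpow hv1.le hr.le, Real.rpow_sub_one hr.ne']
  have := Real.rpow_pos_of_pos hr b
  field_simp

lemma SB_lim1 {b : ℝ} (hb : 0 < b) :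
    Tendsto (fun r : ℝ => r ^ (b + 1) * Real.exp (-2 * r) * SB (b + 3 / 2) (r ^ 2)) atTop
      (𝓝 (1 / (2 * √π))) := by
  have hG := Real.Gamma_pos_of_pos hb
  have key : Tendsto (fun r : ℝ => ∫ v in Ioi (0 : ℝ), (Ioc (0 : ℝ) r).indicator
      (fun v => v ^ (b - 1) * (Real.exp (-2 * r) * Real.sinh (2 * r * √(1 - v / r)))) v) atTop
      (𝓝 (∫ v in Ioi (0 : ℝ), v ^ (b - 1) * (Real.exp (-v) / 2))) := by
    refine tendsto_integral_filter_of_dominated_convergence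
      (fun v => Real.exp (-v) * v ^ (b - 1)) ?_ ?_ (Real.GammaIntegral_convergent hb) ?_
    · refine Eventually.of_forall fun r => ?_
      refine (Measurable.indicator ?_ measurableSet_Ioc).aestronglyMeasurable
      have : Measurable fun v : ℝ => Real.sinh (2 * r * √(1 - v / r)) :=
        (Real.continuous_sinh.measurable).comp (by fun_prop)
      fun_prop
    · filter_upwards [eventually_gt_atTop 0] with r hr
      refine ae_restrict_of_forall_mem measurableSet_Ioi fun v hv => ?_
      have hv : 0 < v := hv
      by_cases hvr : v ∈ Ioc 0 r
      · rw [indicator_of_mem hvr]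
        have hsinh : 0 ≤ Real.sinh (2 * r * √(1 - v / r)) := Real.sinh_nonneg_iff.2 (by positivity)
        rw [Real.norm_of_nonneg (by positivity), mul_comm]
        gcongr
        have h1 : Real.sinh (2 * r * √(1 - v / r)) ≤ Real.exp (2 * r * √(1 - v / r)) := by
          rw [Real.sinh_eq]
          have := Real.exp_pos (2 * r * √(1 - v / r))
          have := Real.exp_pos (-(2 * r * √(1 - v / r)))
          linarith
        calc _ ≤ Real.exp (-2 * r) * Real.exp (2 * r * √(1 - v / r)) := by gcongr
          _ = Real.exp (-2 * r + 2 * r * √(1 - v / r)) := by rw [Real.exp_add]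
          _ ≤ _ := by
            apply Real.exp_le_exp.2
            have := sqrt_bd hr hvr.2
            linarith
      · rw [indicator_of_notMem hvr, norm_zero]
        positivity
    · refine ae_restrict_of_forall_mem measurableSet_Ioi fun v hv => ?_
      refine ((ptlim v).const_mul (v ^ (b - 1))).congr' ?_
      filter_upwards [eventually_ge_atTop v] with r hr
      rw [indicator_of_mem (show v ∈ Ioc 0 r from ⟨hv, hr⟩)]
  have hval : ∫ v in Ioi (0 : ℝ), v ^ (b - 1) * (Real.exp (-v) / 2) = Real.Gamma b / 2 := by
    rw [Real.Gamma_eq_integral hb, ← integral_div]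
    congr 1
    ext v
    ring
  rw [hval] at key
  have hpi : 0 < √π := Real.sqrt_pos.2 Real.pi_pos
  have h2 := key.const_mul (1 / (√π * Real.Gamma b))
  have e : 1 / (√π * Real.Gamma b) * (Real.Gamma b / 2) = 1 / (2 * √π) := by field_simp
  rw [e] at h2
  refine h2.congr' ?_
  filter_upwards [eventually_gt_atTop 0] with r hr
  rw [← SB_scaled hb hr]
  field_simp

/-- normalised asymptotics -/
def AL (b : ℝ) : Prop := Tendsto (fun r : ℝ => r ^ (b - 1 / 2) * Real.exp (-2 * r) * SB b (r ^ 2)) atTop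
      (𝓝 (1 / (2 * √π)))

lemma AL_step {b : ℝ} (hb : 0 < b) (h1 : AL (b + 1)) (h2 : AL (b + 2)) : AL b := by
  unfold AL at *
  have h3 := ((tendsto_inv_atTop_zero.const_mul b).mul h1).add h2
  rw [mul_zero, zero_mul, zero_add] at h3
  refine h3.congr' ?_
  filter_upwards [eventually_gt_atTop 0] with r hr
  have e1 : b + 1 - 1 / 2 = (b - 1 / 2) + 1 := by ring
  have e2 : b + 2 - 1 / 2 = (b - 1 / 2) + (2 : ℕ) := by push_cast; ring
  rw [SB_rec hb (r ^ 2), e1, e2, Real.rpow_add_one hr.ne', Real.rpow_add_natCast hr.ne']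
  field_simp

lemma AL_big {b : ℝ} (hb : 3 / 2 < b) : AL b := by
  have := SB_lim1 (b := b - 3 / 2) (by linarith)
  have e1 : b - 3 / 2 + 1 = b - 1 / 2 := by ring
  have e2 : b - 3 / 2 + 3 / 2 = b := by ring
  rw [e1, e2] at this
  exact this

lemma AL_mid {b : ℝ} (hb : 1 / 2 < b) : AL b :=
  AL_step (by linarith) (AL_big (by linarith)) (AL_big (by linarith))

lemma AL_all {b : ℝ} (hb : 0 < b) : AL b :=
  AL_step (by linarith) (AL_mid (by linarith)) (AL_mid (by linarith))

def rho (b r : ℝ) : ℝ := r ^ (2 - 2 * b) * SB (2 - b) (r ^ 2)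

lemma rho_pos {b : ℝ} (hb1 : b < 1) {r : ℝ} (hr : 0 < r) : 0 < rho b r := by
  have := SB_pos (b := 2 - b) (by linarith) (sq_nonneg r)
  unfold rho
  positivity

lemma rho_deriv {b : ℝ} (hb1 : b < 1) {r : ℝ} (hr : 0 < r) :
    HasDerivAt (rho b) (2 * r ^ (1 - 2 * b) * SB (1 - b) (r ^ 2)) r := by
  have h1 := Real.hasDerivAt_rpow_const (x := r) (p := 2 - 2 * b) (Or.inl hr.ne')
  have h2 := (SB_deriv (b := 2 - b) (by linarith) (r ^ 2)).comp r (hasDerivAt_pow 2 r)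
  have h3 := SB_rec (b := 1 - b) (by linarith) (r ^ 2)
  refine (h1.mul h2).congr_deriv ?_
  have e1 : 2 - 2 * b - 1 = 1 - 2 * b := by ring
  have e2 : 2 - 2 * b = 1 - 2 * b + 1 := by ring
  have e3 : 1 - b + 1 = 2 - b := by ring
  have e4 : 1 - b + 2 = 2 - b + 1 := by ring
  rw [e3, e4] at h3
  rw [h3, e1, e2, Real.rpow_add_one hr.ne']
  simp only [Function.comp]
  push_cast
  ring

def GG (b r : ℝ) : ℝ := SB b (r ^ 2) / rho b r - 1

def ww (b : ℝ) : ℝ := 1 / (Real.Gamma b * Real.Gamma (1 - b))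

lemma ww_pos {b : ℝ} (hb : 0 < b) (hb1 : b < 1) : 0 < ww b := by
  have := Real.Gamma_pos_of_pos hb
  have := Real.Gamma_pos_of_pos (s := 1 - b) (by linarith)
  unfold ww
  positivity

lemma GG_deriv {b : ℝ} (hb : 0 < b) (hb1 : b < 1) {r : ℝ} (hr : 0 < r) :
    HasDerivAt (GG b) (-(2 * ww b * r ^ (1 - 2 * b) / rho b r ^ 2)) r := by
  have h1 := (SB_deriv hb (r ^ 2)).comp r (hasDerivAt_pow 2 r)
  have h2 := rho_deriv hb1 hr
  have hp := rho_pos hb1 hr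
  refine ((h1.div h2 hp.ne').sub_const 1).congr_deriv ?_
  rw [ww, ← SB_wronsk hb hb1 (r ^ 2), ← neg_div]
  congr 1
  have e2 : 2 - 2 * b = 1 - 2 * b + 1 := by ring
  rw [rho, e2, Real.rpow_add_one hr.ne']
  simp only [Function.comp]
  push_cast
  ring

lemma rho_lim {b : ℝ} (hb1 : b < 1) :
    Tendsto (fun r : ℝ => r ^ (b - 1 / 2) * Real.exp (-2 * r) * rho b r) atTop (𝓝 (1 / (2 * √π))) := by
  refine (AL_all (b := 2 - b) (by linarith)).congr' ?_
  filter_upwards [eventually_gt_atTop 0] with r hr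
  have : 2 - b - 1 / 2 = (b - 1 / 2) + (2 - 2 * b) := by ring
  rw [this, Real.rpow_add hr, rho]
  ring

lemma Lpos : 0 < 1 / (2 * √π) := by
  have hpi : 0 < √π := Real.sqrt_pos.2 Real.pi_pos
  positivity

lemma GG_lim {b : ℝ} (hb : 0 < b) (hb1 : b < 1) : Tendsto (GG b) atTop (𝓝 0) := by
  have h := ((AL_all hb).div (rho_lim hb1) Lpos.ne').sub_const 1
  rw [div_self Lpos.ne', sub_self] at h
  refine h.congr' ?_
  filter_upwards [eventually_gt_atTop 0] with r hr
  have := Real.rpow_pos_of_pos hr (b - 1 / 2)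
  have := Real.exp_pos (-2 * r)
  simp only [Pi.div_apply]
  rw [GG, mul_div_mul_left _ _ (by positivity)]

lemma GG_pos {b : ℝ} (hb : 0 < b) (hb1 : b < 1) {r : ℝ} (hr : 0 < r) : 0 < GG b r := by
  have hanti : StrictAntiOn (GG b) (Ioi 0) := by
    refine strictAntiOn_of_deriv_neg (convex_Ioi 0)
      (fun x hx => (GG_deriv hb hb1 hx).continuousAt.continuousWithinAt) ?_
    intro x hx
    rw [interior_Ioi] at hx
    rw [(GG_deriv hb hb1 hx).deriv]
    have hx : 0 < x := hx
    have := rho_pos hb1 hx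
    have := ww_pos hb hb1
    rw [neg_lt_zero]
    positivity
  have h1 : GG b (r + 1) < GG b r := hanti (show 0 < r from hr) (show 0 < r + 1 by linarith) (by linarith)
  have h2 : 0 ≤ GG b (r + 1) := by
    refine le_of_tendsto (GG_lim hb hb1) ?_
    filter_upwards [eventually_gt_atTop (r + 1)] with x hx
    exact (hanti (show 0 < r + 1 by linarith) (show 0 < x by linarith) hx).le
  linarith

lemma GG_exp_lim {b : ℝ} (hb : 0 < b) (hb1 : b < 1) :
    Tendsto (fun r => GG b r / Real.exp (-4 * r)) atTop (𝓝 (ww b / 2 / (1 / (2 * √π)) ^ 2)) := by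
  refine HasDerivAt.lhopital_zero_atTop (f' := fun r => -(2 * ww b * r ^ (1 - 2 * b) / rho b r ^ 2))
    (g' := fun r => Real.exp (-4 * r) * (-4)) ?_ ?_ ?_ (GG_lim hb hb1) ?_ ?_
  · filter_upwards [eventually_gt_atTop 0] with r hr using GG_deriv hb hb1 hr
  · refine Eventually.of_forall fun r => ?_
    have := ((hasDerivAt_id r).const_mul (-4)).exp
    simpa using this
  · refine Eventually.of_forall fun r => ?_
    have := Real.exp_pos (-4 * r)
    simp [this.ne']
  · refine Real.tendsto_exp_atBot.comp ?_
    exact tendsto_id.const_mul_atTop_of_neg (by norm_num)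
  · have h := (tendsto_const_nhds (x := ww b / 2)).div ((rho_lim hb1).pow 2) (by have := Lpos; positivity)
    refine h.congr' ?_
    filter_upwards [eventually_gt_atTop 0] with r hr
    have := rho_pos hb1 hr
    have e1 : (r ^ (b - 1 / 2)) ^ 2 = (r ^ (1 - 2 * b))⁻¹ := by
      rw [← Real.rpow_mul_natCast hr.le, ← Real.rpow_neg hr.le]
      congr 1
      push_cast
      ring
    have e2 : Real.exp (-4 * r) = Real.exp (-2 * r) ^ 2 := by
      rw [← Real.exp_nat_mul]
      congr 1
      push_cast
      ring
    have := Real.rpow_pos_of_pos hr (1 - 2 * b)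
    have := Real.exp_pos (-2 * r)
    simp only [Pi.div_apply]
    rw [mul_pow, mul_pow, e1, e2]
    field_simp
    norm_num

lemma bound_lemma {f : ℝ → ℝ} {s M : ℝ} (hc : ContinuousOn f (Ici 0)) (hp : ∀ r, 0 ≤ r → 0 < f r)
    (hM : 0 < M) (hl : Tendsto (fun r => r ^ s * f r) atTop (𝓝 M)) :
    ∃ c C : ℝ, 0 < c ∧ ∀ r, 0 ≤ r → c ≤ (1 + 4 * r) ^ s * f r ∧ (1 + 4 * r) ^ s * f r ≤ C := by
  have h1 : Tendsto (fun r : ℝ => (r⁻¹ + 4) ^ s) atTop (𝓝 (4 ^ s)) := by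
    have : Tendsto (fun r : ℝ => r⁻¹ + 4) atTop (𝓝 (0 + 4)) := tendsto_inv_atTop_zero.add_const 4
    rw [zero_add] at this
    exact this.rpow_const (Or.inl (by norm_num))
  have h2 : Tendsto (fun r : ℝ => (1 + 4 * r) ^ s * f r) atTop (𝓝 (4 ^ s * M)) := by
    refine (h1.mul hl).congr' ?_
    filter_upwards [eventually_gt_atTop 0] with r hr
    rw [← mul_assoc, ← Real.mul_rpow (by positivity) hr.le]
    congr 2
    field_simp
  set N := 4 ^ s * M with hN
  have hNp : 0 < N := by positivity
  have h3 := (h2.eventually (Ioi_mem_nhds (show N / 2 < N by linarith))).and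
    (h2.eventually (Iio_mem_nhds (show N < 2 * N by linarith)))
  obtain ⟨R, hR⟩ := eventually_atTop.1 h3
  set R' := max R 0
  have hcont : ContinuousOn (fun r : ℝ => (1 + 4 * r) ^ s * f r) (Icc 0 R') := by
    refine ContinuousOn.mul (ContinuousOn.rpow_const (by fun_prop) ?_) (hc.mono fun x hx => hx.1)
    intro x hx
    left
    have := hx.1
    positivity
  have hne : (Icc 0 R').Nonempty := ⟨0, le_refl _, le_max_right _ _⟩
  obtain ⟨x, hx, hxm⟩ := isCompact_Icc.exists_isMinOn hne hcont
  obtain ⟨y, hy, hym⟩ := isCompact_Icc.exists_isMaxOn hne hcont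
  have hxp : 0 < (1 + 4 * x) ^ s * f x := by
    have := hx.1
    have := hp x this
    positivity
  refine ⟨min (N / 2) ((1 + 4 * x) ^ s * f x), max (2 * N) ((1 + 4 * y) ^ s * f y),
    lt_min (by linarith) hxp, ?_⟩
  intro r hr
  by_cases hrR : r ≤ R'
  · exact ⟨(min_le_right _ _).trans (hxm ⟨hr, hrR⟩), le_trans (hym ⟨hr, hrR⟩) (le_max_right _ _)⟩
  · have := hR r ((le_max_left _ _).trans (not_le.1 hrR).le)
    exact ⟨(min_le_left _ _).trans (le_of_lt this.1), le_trans (le_of_lt this.2) (le_max_left _ _)⟩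

lemma rho_cont {b : ℝ} (hb1 : b < 1) : Continuous (rho b) := by
  unfold rho
  refine Continuous.mul (Real.continuous_rpow_const (by linarith)) ?_
  exact (SB_cont (by linarith)).comp (by fun_prop)

lemma rho_nonneg {b : ℝ} (hb1 : b < 1) {r : ℝ} (hr : 0 ≤ r) : 0 ≤ rho b r := by
  have := SB_pos (b := 2 - b) (by linarith) (sq_nonneg r)
  unfold rho
  positivity

lemma plus_bound {b : ℝ} (hb : 0 < b) (hb1 : b < 1) :
    ∃ c C : ℝ, 0 < c ∧ ∀ r, 0 ≤ r →
      c ≤ (1 + 4 * r) ^ (b - 1 / 2) * (Real.exp (-2 * r) * (SB b (r ^ 2) + rho b r)) ∧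
      (1 + 4 * r) ^ (b - 1 / 2) * (Real.exp (-2 * r) * (SB b (r ^ 2) + rho b r)) ≤ C := by
  refine bound_lemma (M := 1 / (2 * √π) + 1 / (2 * √π)) ?_ ?_ (add_pos Lpos Lpos) ?_
  · have h1 := rho_cont hb1
    have h2 : Continuous fun r : ℝ => SB b (r ^ 2) := (SB_cont hb).comp (by fun_prop)
    exact Continuous.continuousOn (by fun_prop)
  · intro r hr
    have := SB_pos hb (sq_nonneg r)
    have := rho_nonneg hb1 hr
    positivity
  · refine ((AL_all hb).add (rho_lim hb1)).congr fun r => ?_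
    ring

lemma minus_bound {b : ℝ} (hb : 0 < b) (hb1 : b < 1) :
    ∃ c C : ℝ, 0 < c ∧ ∀ r, 0 ≤ r →
      c ≤ (1 + 4 * r) ^ (b - 1 / 2) * (Real.exp (2 * r) * (SB b (r ^ 2) - rho b r)) ∧
      (1 + 4 * r) ^ (b - 1 / 2) * (Real.exp (2 * r) * (SB b (r ^ 2) - rho b r)) ≤ C := by
  refine bound_lemma (M := ww b / 2 / (1 / (2 * √π)) ^ 2 * (1 / (2 * √π))) ?_ ?_ ?_ ?_
  · have h1 := rho_cont hb1
    have h2 : Continuous fun r : ℝ => SB b (r ^ 2) := (SB_cont hb).comp (by fun_prop)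
    exact Continuous.continuousOn (by fun_prop)
  · intro r hr
    refine mul_pos (Real.exp_pos _) ?_
    rcases hr.eq_or_lt with rfl | hr
    · have := SB_pos hb (sq_nonneg 0)
      rw [rho, Real.zero_rpow (by linarith), zero_mul, sub_zero]
      exact this
    · have h1 := GG_pos hb hb1 hr
      rw [GG, sub_pos, one_lt_div (rho_pos hb1 hr)] at h1
      linarith
  · have := ww_pos hb hb1
    have := Lpos
    positivity
  · refine ((GG_exp_lim hb hb1).mul (rho_lim hb1)).congr' ?_
    filter_upwards [eventually_gt_atTop 0] with r hr
    have := rho_pos hb1 hr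
    have e1 : Real.exp (-4 * r) = (Real.exp (2 * r))⁻¹ ^ 2 := by
      rw [← Real.exp_neg, ← Real.exp_nat_mul]
      congr 1
      push_cast
      ring
    have e2 : Real.exp (-2 * r) = (Real.exp (2 * r))⁻¹ := by
      rw [← Real.exp_neg]; congr 1; ring
    have := Real.exp_pos (2 * r)
    rw [GG, e1, e2]
    field_simp

lemma Fker_eq (a z : ℝ) : Fker a z = Real.exp (-z / 2) * (SB ((a + 1) / 2) ((z / 4) ^ 2) +
    z / 4 * |z / 4| ^ (-a) * SB (2 - (a + 1) / 2) ((z / 4) ^ 2)) := by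
  unfold Fker SB
  have e1 : ∀ k : ℕ, (k : ℝ) + (a - 1) / 2 + 1 = k + (a + 1) / 2 := fun k => by ring
  have e2 : ∀ k : ℕ, (k : ℝ) - (a - 1) / 2 + 1 = k + (2 - (a + 1) / 2) := fun k => by ring
  simp only [e1, e2, pow_mul]

lemma rr {a r : ℝ} (ha : a < 1) (hr : 0 ≤ r) : r * r ^ (-a) = r ^ (2 - 2 * ((a + 1) / 2)) := by
  have e : 2 - 2 * ((a + 1) / 2) = 1 + -a := by ring
  rw [e]
  rcases hr.eq_or_lt with rfl | hr
  · rw [zero_mul, Real.zero_rpow (by linarith)]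
  · rw [Real.rpow_add hr, Real.rpow_one]

lemma Fker_bound {a : ℝ} (ha₁ : -1 < a) (ha₂ : a < 1) :
    ∃ c C : ℝ, 0 < c ∧ ∀ z, c ≤ (1 + |z|) ^ (a / 2) * Fker a z ∧ (1 + |z|) ^ (a / 2) * Fker a z ≤ C := by
  obtain ⟨c1, C1, h1, hp⟩ := plus_bound (b := (a + 1) / 2) (by linarith) (by linarith)
  obtain ⟨c2, C2, h2, hm⟩ := minus_bound (b := (a + 1) / 2) (by linarith) (by linarith)
  refine ⟨min c1 c2, max C1 C2, lt_min h1 h2, fun z => ?_⟩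
  have e : (a + 1) / 2 - 1 / 2 = a / 2 := by ring
  rw [e] at hp hm
  rw [Fker_eq]
  rcases le_total 0 z with hz | hz
  · have hr : 0 ≤ z / 4 := by linarith
    have hb := hp (z / 4) hr
    rw [rho, ← rr ha₂ hr] at hb
    rw [abs_of_nonneg hz, abs_of_nonneg hr]
    have e1 : -z / 2 = -2 * (z / 4) := by ring
    have e2 : 1 + 4 * (z / 4) = 1 + z := by ring
    rw [e2] at hb
    rw [e1]
    exact ⟨(min_le_left _ _).trans hb.1, hb.2.trans (le_max_left _ _)⟩
  · have hr : 0 ≤ -(z / 4) := by linarith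
    have hb := hm (-(z / 4)) hr
    rw [rho, ← rr ha₂ hr] at hb
    rw [abs_of_nonpos hz, abs_of_nonpos (show z / 4 ≤ 0 by linarith)]
    have e1 : 2 * -(z / 4) = -z / 2 := by ring
    have e2 : 1 + 4 * -(z / 4) = 1 + -z := by ring
    rw [e2, e1, neg_sq, sub_eq_add_neg, neg_mul, neg_mul, neg_neg] at hb
    exact ⟨(min_le_right _ _).trans hb.1, hb.2.trans (le_max_right _ _)⟩

/-- Two-sided Gaussian-type bounds for the degenerate heat kernel: there are constants
`0 < c ≤ C` depending only on `a` with
`c t^{-(1+a)/2} e^{-(x-y)²/(4t)} (1+|xy/t|)^{-a/2} ≤ ũ(x,y,t) ≤ C t^{-(1+a)/2} e^{-(x-y)²/(4t)} (1+|xy/t|)^{-a/2}`. -/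
theorem utilde_two_sided_bounds (a : ℝ) (ha₁ : -1 < a) (ha₂ : a < 1) :
    ∃ c C : ℝ, 0 < c ∧ c ≤ C ∧ ∀ x y t : ℝ, 0 < t →
      c * t ^ (-(1 + a) / 2) * Real.exp (-|x - y| ^ 2 / (4 * t)) * (1 + |x * y / t|) ^ (-a / 2)
          ≤ utilde a x y t ∧
      utilde a x y t
          ≤ C * t ^ (-(1 + a) / 2) * Real.exp (-|x - y| ^ 2 / (4 * t)) *
              (1 + |x * y / t|) ^ (-a / 2) := by
  obtain ⟨c, C, hc, h⟩ := Fker_bound ha₁ ha₂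
  have hcC : c ≤ C := (h 0).1.trans (h 0).2
  set d : ℝ := 4 ^ (-(a + 1) / 2) with hd
  have hdp : 0 < d := by positivity
  refine ⟨d * c, d * C, by positivity, by gcongr, ?_⟩
  intro x y t ht
  obtain ⟨hl, hu⟩ := h (x * y / t)
  set z := x * y / t
  have hz : 0 < 1 + |z| := by positivity
  have hzp := Real.rpow_pos_of_pos hz (a / 2)
  have e0 : (1 + |z|) ^ (-a / 2) = ((1 + |z|) ^ (a / 2))⁻¹ := by
    rw [neg_div, Real.rpow_neg hz.le]
  have e1 : (4 * t) ^ (-(a + 1) / 2) = d * t ^ (-(1 + a) / 2) := by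
    rw [Real.mul_rpow (by norm_num) ht.le, hd, add_comm 1 a]
  have ht' := Real.rpow_pos_of_pos ht (-(1 + a) / 2)
  have he := Real.exp_pos (-(x - y) ^ 2 / (4 * t))
  have hF : Fker a z = (1 + |z|) ^ (a / 2) * Fker a z * ((1 + |z|) ^ (a / 2))⁻¹ := by
    field_simp
  rw [utilde, sq_abs, e0, e1]
  change _ ≤ _ * _ * Fker a z ∧ _ * _ * Fker a z ≤ _
  rw [hF]
  set K := (1 + |z|) ^ (a / 2) * Fker a z
  set T := t ^ (-(1 + a) / 2)
  set X := Real.exp (-(x - y) ^ 2 / (4 * t))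
  set Z := ((1 + |z|) ^ (a / 2))⁻¹
  have hZ : 0 < Z := by positivity
  constructor
  · calc d * c * T * X * Z = (d * T * X * Z) * c := by ring
      _ ≤ (d * T * X * Z) * K := by gcongr
      _ = _ := by ring
  · calc d * T * X * (K * Z) = (d * T * X * Z) * K := by ring
      _ ≤ (d * T * X * Z) * C := by gcongr
      _ = _ := by ring
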